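/- Isometry Theorem: For any two persistence modules V and W with barcodes B(V) and B(W) (i.e., finite multisets of intervals with V ≅ ⊕_{I∈B(V)} 𝔽(I) and W ≅ ⊕_{J∈B(W)} 𝔽(J)), one has d_int(V,W) = d_bot(B(V), B(W)). -/

import Mathlib

open Classical

noncomputable section

/-- A persistence module over a field `𝔽`: a family of finite-dimensional vector
spaces indexed by `ℝ` together with transition maps satisfying the persistence laws. -/
structure PersistenceModule (𝔽 : Type) [Field 𝔽] where
  V : ℝ → Type
  [grp : ∀ t, AddCommGroup (V t)]
  [mod : ∀ t, Module 𝔽 (V t)]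
  [fin : ∀ t, FiniteDimensional 𝔽 (V t)]
  π : ∀ s t : ℝ, s ≤ t → (V s →ₗ[𝔽] V t)
  π_refl : ∀ t : ℝ, π t t le_rfl = LinearMap.id
  π_comp : ∀ (s t r : ℝ) (hst : s ≤ t) (htr : t ≤ r),
    (π t r htr).comp (π s t hst) = π s r (hst.trans htr)

attribute [instance] PersistenceModule.grp PersistenceModule.mod PersistenceModule.fin

namespace PersistenceModule

variable {𝔽 : Type} [Field 𝔽]

/-- The regularity ("finite type", semicontinuity and lower-boundedness) axioms of a
persistence module: away from a finite set, transition maps are locally isomorphisms;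
the module is semicontinuous from the left; and it vanishes for `s` sufficiently small. -/
def IsRegular (M : PersistenceModule 𝔽) : Prop :=
  (∃ S : Finset ℝ, ∀ t : ℝ, t ∉ S → ∃ U ∈ nhds t,
    ∀ s ∈ U, ∀ r ∈ U, ∀ h : s ≤ r, Function.Bijective (M.π s r h)) ∧
  (∀ t : ℝ, ∃ ε : ℝ, 0 < ε ∧ ∀ s : ℝ, t - ε < s → ∀ h : s ≤ t, Function.Bijective (M.π s t h)) ∧
  (∃ s₀ : ℝ, ∀ s : ℝ, s ≤ s₀ → ∀ x : M.V s, x = 0)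

/-- A morphism of persistence modules. -/
structure Hom (M N : PersistenceModule 𝔽) where
  A : ∀ t : ℝ, M.V t →ₗ[𝔽] N.V t
  comm : ∀ (s t : ℝ) (h : s ≤ t), (A t).comp (M.π s t h) = (N.π s t h).comp (A s)

/-- Two persistence modules are isomorphic if there are mutually inverse morphisms. -/
def Iso (M N : PersistenceModule 𝔽) : Prop :=
  ∃ (f : Hom M N) (g : Hom N M),
    (∀ (t : ℝ) (x : M.V t), g.A t (f.A t x) = x) ∧
    (∀ (t : ℝ) (y : N.V t), f.A t (g.A t y) = y)

/-- `δ`-interleaving of two persistence modules, stated pointwise (`F, G` are the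
interleaving morphisms `V → W[δ]`, `W → V[δ]`, and the two triangles express that the
compositions are the `2δ`-shift morphisms). -/
def Interleaved (M N : PersistenceModule 𝔽) (δ : ℝ) : Prop :=
  ∃ (F : ∀ t : ℝ, M.V t →ₗ[𝔽] N.V (t + δ)) (G : ∀ t : ℝ, N.V t →ₗ[𝔽] M.V (t + δ)),
    (∀ (s t : ℝ) (h : s ≤ t),
      (F t).comp (M.π s t h) = (N.π (s + δ) (t + δ) (by linarith)).comp (F s)) ∧
    (∀ (s t : ℝ) (h : s ≤ t),
      (G t).comp (N.π s t h) = (M.π (s + δ) (t + δ) (by linarith)).comp (G s)) ∧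
    (∀ (t : ℝ) (h : t ≤ t + δ + δ),
      (G (t + δ)).comp (F t) = M.π t (t + δ + δ) h) ∧
    (∀ (t : ℝ) (h : t ≤ t + δ + δ),
      (F (t + δ)).comp (G t) = N.π t (t + δ + δ) h)

/-- Interleaving distance, with value in `EReal` (`+∞` if no interleaving exists). -/
def dInt (M N : PersistenceModule 𝔽) : EReal :=
  sInf {x : EReal | ∃ δ : ℝ, 0 < δ ∧ x = (δ : EReal) ∧ Interleaved M N δ}

/-- The persistence submodule of `(-1)`-eigenspaces of an endomorphism `A` of `M`. -/
def negEigen (M : PersistenceModule 𝔽) (A : Hom M M) : PersistenceModule 𝔽 where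
  V t := ↥(LinearMap.ker (A.A t + (LinearMap.id : M.V t →ₗ[𝔽] M.V t)))
  π s t h := LinearMap.restrict (M.π s t h) (by
    intro x hx
    have hc := congrArg (fun f : M.V s →ₗ[𝔽] M.V t => f x) (A.comm s t h)
    simp only [LinearMap.comp_apply] at hc
    simp only [LinearMap.mem_ker, LinearMap.add_apply, LinearMap.id_apply] at hx ⊢
    rw [hc, ← map_add (M.π s t h), hx, map_zero])
  π_refl t := by
    apply LinearMap.ext
    intro x
    apply Subtype.ext
    have := congrArg (fun f : M.V t →ₗ[𝔽] M.V t => f (x : M.V t)) (M.π_refl t)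
    simpa [LinearMap.restrict_apply] using this
  π_comp s t r hst htr := by
    apply LinearMap.ext
    intro x
    apply Subtype.ext
    have := congrArg (fun f : M.V s →ₗ[𝔽] M.V r => f (x : M.V s)) (M.π_comp s t r hst htr)
    simpa [LinearMap.restrict_apply] using this

/-- `(δ, ℤ₂)`-equivariant interleaving of two persistence modules with involutions
`AM` and `AN`. -/
def Z2Interleaved (M N : PersistenceModule 𝔽) (AM : Hom M M) (AN : Hom N N) (δ : ℝ) : Prop :=
  ∃ (F : ∀ t : ℝ, M.V t →ₗ[𝔽] N.V (t + δ)) (G : ∀ t : ℝ, N.V t →ₗ[𝔽] M.V (t + δ)),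
    (∀ (s t : ℝ) (h : s ≤ t),
      (F t).comp (M.π s t h) = (N.π (s + δ) (t + δ) (by linarith)).comp (F s)) ∧
    (∀ (s t : ℝ) (h : s ≤ t),
      (G t).comp (N.π s t h) = (M.π (s + δ) (t + δ) (by linarith)).comp (G s)) ∧
    (∀ (t : ℝ) (h : t ≤ t + δ + δ),
      (G (t + δ)).comp (F t) = M.π t (t + δ + δ) h) ∧
    (∀ (t : ℝ) (h : t ≤ t + δ + δ),
      (F (t + δ)).comp (G t) = N.π t (t + δ + δ) h) ∧
    (∀ t : ℝ, (F t).comp (AM.A t) = (AN.A (t + δ)).comp (F t)) ∧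
    (∀ t : ℝ, (G t).comp (AN.A t) = (AM.A (t + δ)).comp (G t))

/-- The `ℤ₂`-interleaving distance, with value in `EReal`. -/
def dZ2Int (M N : PersistenceModule 𝔽) (AM : Hom M M) (AN : Hom N N) : EReal :=
  sInf {x : EReal | ∃ δ : ℝ, 0 < δ ∧ x = (δ : EReal) ∧ Z2Interleaved M N AM AN δ}

end PersistenceModule

/-- A bar `(a, b]` is recorded as the pair of its left endpoint `a ∈ ℝ`
and its right endpoint `b ∈ ℝ ∪ {±∞}`. -/
abbrev Bar := ℝ × EReal

/-- A bar is valid if `a < b` (so it encodes a nonempty interval `(a,b]`, `b ≤ +∞`). -/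
def Bar.valid (I : Bar) : Prop := (I.1 : EReal) < I.2

/-- Membership `t ∈ (a, b]`. -/
def Bar.has (I : Bar) (t : ℝ) : Prop := I.1 < t ∧ (t : EReal) ≤ I.2

/-- The fiber at `t` of the interval module of `I`, as a submodule of `𝔽`. -/
def barSub (𝔽 : Type) [Field 𝔽] (I : Bar) (t : ℝ) : Submodule 𝔽 𝔽 :=
  if Bar.has I t then ⊤ else ⊥

lemma barSub_coe_zero {𝔽 : Type} [Field 𝔽] {I : Bar} {t : ℝ}
    (hm : ¬ Bar.has I t) (x : barSub 𝔽 I t) : (x : 𝔽) = 0 := by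
  have hx := x.2
  simp only [barSub, if_neg hm, Submodule.mem_bot] at hx
  exact hx

/-- The transition maps of an interval module. -/
def barMap (𝔽 : Type) [Field 𝔽] (I : Bar) (s t : ℝ) :
    barSub 𝔽 I s →ₗ[𝔽] barSub 𝔽 I t where
  toFun x := ⟨if Bar.has I t then (x : 𝔽) else 0, by
    split_ifs with hm
    · simp [barSub, hm]
    · exact (barSub 𝔽 I t).zero_mem⟩
  map_add' x y := by
    apply Subtype.ext
    by_cases hm : Bar.has I t <;> simp [hm]
  map_smul' c x := by
    apply Subtype.ext
    by_cases hm : Bar.has I t <;> simp [hm]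

lemma barMap_coe (𝔽 : Type) [Field 𝔽] (I : Bar) (s t : ℝ) (x : barSub 𝔽 I s) :
    (barMap 𝔽 I s t x : 𝔽) = if Bar.has I t then (x : 𝔽) else 0 := rfl

lemma barMap_refl {𝔽 : Type} [Field 𝔽] {I : Bar} {t : ℝ} (x : barSub 𝔽 I t) :
    barMap 𝔽 I t t x = x := by
  apply Subtype.ext
  rw [barMap_coe]
  split_ifs with hm
  · rfl
  · exact (barSub_coe_zero hm x).symm

lemma barMap_comp {𝔽 : Type} [Field 𝔽] {I : Bar} {s t r : ℝ} (hst : s ≤ t) (htr : t ≤ r)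
    (x : barSub 𝔽 I s) :
    barMap 𝔽 I t r (barMap 𝔽 I s t x) = barMap 𝔽 I s r x := by
  apply Subtype.ext
  rw [barMap_coe, barMap_coe, barMap_coe]
  by_cases hr : Bar.has I r
  · by_cases ht : Bar.has I t
    · simp [hr, ht]
    · have ht2 : (t : EReal) ≤ I.2 := le_trans (by exact_mod_cast htr) hr.2
      have ht1 : ¬ I.1 < t := fun h => ht ⟨h, ht2⟩
      have hs1 : ¬ Bar.has I s := fun hs => ht1 (lt_of_lt_of_le hs.1 hst)
      rw [barSub_coe_zero hs1 x]
      simp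
  · simp [hr]

/-- The interval persistence module `𝔽(a,b]`. -/
def intervalModule (𝔽 : Type) [Field 𝔽] (I : Bar) : PersistenceModule 𝔽 where
  V t := ↥(barSub 𝔽 I t)
  π s t _ := barMap 𝔽 I s t
  π_refl t := LinearMap.ext fun x => barMap_refl x
  π_comp _ _ _ hst htr := LinearMap.ext fun x => barMap_comp hst htr x

/-- The direct sum `⊕_{I ∈ B} 𝔽(I)` of the interval modules of the bars of a
barcode `B` (a finite multiset of bars), taken pointwise in `t`. -/
def barcodeModule (𝔽 : Type) [Field 𝔽] (B : Multiset Bar) : PersistenceModule 𝔽 where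
  V t := ∀ i : Fin B.toList.length, ↥(barSub 𝔽 (B.toList.get i) t)
  π s t _ := LinearMap.pi fun i => (barMap 𝔽 (B.toList.get i) s t).comp (LinearMap.proj i)
  π_refl t := by
    apply LinearMap.ext
    intro x
    funext i
    simpa using barMap_refl (x i)
  π_comp s t r hst htr := by
    apply LinearMap.ext
    intro x
    funext i
    simpa using barMap_comp hst htr (x i)

/-- `Multiset.filter` with classical decidability. -/
def cfilter {α : Type} (p : α → Prop) (s : Multiset α) : Multiset α :=
  @Multiset.filter α p (Classical.decPred p) s

/-- A bar of length `> 2δ`. -/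
def BarLong (δ : ℝ) (I : Bar) : Prop := ((2 * δ : ℝ) : EReal) < I.2 - (I.1 : EReal)

/-- Two bars matched within error `δ`: left endpoints within `δ` of each other, and
either both right endpoints equal `+∞`, or both are finite and within `δ`. -/
def BarClose (δ : ℝ) (I J : Bar) : Prop :=
  |I.1 - J.1| ≤ δ ∧
    ((I.2 = ⊤ ∧ J.2 = ⊤) ∨ (I.2 ≠ ⊤ ∧ J.2 ≠ ⊤ ∧ |EReal.toReal I.2 - EReal.toReal J.2| ≤ δ))

/-- A `δ`-matching between barcodes `B` and `C`, recorded as a multiset `m` of matched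
pairs: it induces a partial bijection between a sub-multiset of `B` and a sub-multiset
of `C` which matches every bar of length `> 2δ` on both sides, and matched bars are
`δ`-close. -/
def IsMatching (δ : ℝ) (B C : Multiset Bar) (m : Multiset (Bar × Bar)) : Prop :=
  m.map Prod.fst ≤ B ∧ m.map Prod.snd ≤ C ∧
  cfilter (BarLong δ) B ≤ m.map Prod.fst ∧
  cfilter (BarLong δ) C ≤ m.map Prod.snd ∧
  ∀ p ∈ m, BarClose δ p.1 p.2

/-- The bottleneck distance between two barcodes, with value in `EReal`. -/
def dBot (B C : Multiset Bar) : EReal :=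
  sInf {x : EReal | ∃ δ : ℝ, 0 < δ ∧ x = (δ : EReal) ∧ ∃ m, IsMatching δ B C m}

/-- `m(B, (a,b])`: the number of bars of `B` (with multiplicity) containing `(a,b]`. -/
def multB (B : Multiset Bar) (a b : ℝ) : ℕ :=
  (cfilter (fun I : Bar => I.1 ≤ a ∧ (b : EReal) ≤ I.2) B).card

/-- The multiplicity function `μ_k` of a barcode, with value in `EReal`
(it equals `0` if no suitable `c` exists). -/
def muk (k : ℕ) (B : Multiset Bar) : EReal :=
  sSup (insert (0 : EReal)
    {x : EReal | ∃ c : ℝ, 0 < c ∧ x = (c : EReal) ∧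
      ∃ a b : ℝ, 4 * c < b - a ∧ multB B a b = k ∧ multB B (a + 2 * c) (b - 2 * c) = k})

/-- `μ_odd`: the supremum of `μ_k` over odd `k`. -/
def muOdd (B : Multiset Bar) : EReal :=
  sSup {x : EReal | ∃ k : ℕ, Odd k ∧ x = muk k B}

/-- `β_k`: the length of the `k`-th longest finite bar of a barcode (`0` if there are
fewer than `k` finite bars). -/
def betak (k : ℕ) (B : Multiset Bar) : ℝ :=
  ((((cfilter (fun I : Bar => I.2 ≠ ⊤) B).map
      (fun I : Bar => EReal.toReal I.2 - I.1)).sort (· ≤ ·)).reverse).getD (k - 1) 0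

end

section BarGeometry

lemma Bar.valid.ne_bot {I : Bar} (h : Bar.valid I) : I.2 ≠ ⊥ := by
  rintro h'
  simp [Bar.valid, h'] at h

lemma BarClose.symm {δ : ℝ} {I J : Bar} (h : BarClose δ I J) : BarClose δ J I := by
  obtain ⟨h1, h2⟩ := h
  refine ⟨by rwa [abs_sub_comm], ?_⟩
  rcases h2 with ⟨h2, h3⟩ | ⟨h2, h3, h4⟩
  · exact Or.inl ⟨h3, h2⟩
  · exact Or.inr ⟨h3, h2, by rwa [abs_sub_comm]⟩

/-- Nonzero morphisms `𝔽(I) → 𝔽(J)[δ]` exist only if both endpoints of `J` are at most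
`δ` above those of `I`. -/
def BarShiftLE (δ : ℝ) (I J : Bar) : Prop :=
  J.1 ≤ I.1 + δ ∧ ∀ r : ℝ, ((r + δ : ℝ) : EReal) ≤ J.2 → (r : EReal) ≤ I.2

lemma barShiftLE_coe_coe {δ a b c d : ℝ} :
    BarShiftLE δ (a, (b : EReal)) (c, (d : EReal)) ↔ c ≤ a + δ ∧ d ≤ b + δ := by
  simp only [BarShiftLE, EReal.coe_le_coe_iff]
  refine and_congr_right fun _ => ⟨fun h => ?_, fun h r hr => by linarith⟩
  linarith [h (d - δ) (by linarith)]

lemma barShiftLE_top_left {δ a c : ℝ} {d : EReal} :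
    BarShiftLE δ (a, ⊤) (c, d) ↔ c ≤ a + δ := by
  simp [BarShiftLE]

lemma not_barShiftLE_coe_top {δ a b c : ℝ} :
    ¬ BarShiftLE δ (a, (b : EReal)) (c, ⊤) := by
  simp only [BarShiftLE, le_top, forall_const, EReal.coe_le_coe_iff, not_and, not_forall]
  exact fun _ => ⟨b + 1, by linarith⟩

lemma barClose_iff {δ : ℝ} {I J : Bar} (hI : I.2 ≠ ⊥) (hJ : J.2 ≠ ⊥) :
    BarClose δ I J ↔ BarShiftLE δ I J ∧ BarShiftLE δ J I := by
  obtain ⟨a, b⟩ := I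
  obtain ⟨c, d⟩ := J
  induction b <;> induction d <;>
    simp_all [BarClose, barShiftLE_coe_coe, barShiftLE_top_left, not_barShiftLE_coe_top, abs_le] <;>
    grind

/-- Bars ordered by their midpoint, the infinite ones coming last and ordered by their
left endpoint. -/
noncomputable def Bar.key (I : Bar) : ℕ ×ₗ ℝ :=
  toLex (if I.2 = ⊤ then 1 else 0, I.1 + I.2.toReal)

lemma BarShiftLE.close_or_close {δ : ℝ} {I J K : Bar} (hI : I.2 ≠ ⊥) (hJ : J.2 ≠ ⊥)
    (hK : K.2 ≠ ⊥) (hIJ : BarShiftLE δ I J) (hJK : BarShiftLE δ J K) (h : I.key ≤ K.key) :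
    BarClose δ I J ∨ BarClose δ K J := by
  rw [barClose_iff hI hJ, barClose_iff hK hJ]
  suffices BarShiftLE δ J I ∨ BarShiftLE δ K J by tauto
  obtain ⟨a, b⟩ := I
  obtain ⟨c, d⟩ := J
  obtain ⟨a', b'⟩ := K
  induction b <;> induction d <;> induction b' <;>
    simp_all [barShiftLE_coe_coe, barShiftLE_top_left, not_barShiftLE_coe_top, Bar.key,
      Prod.Lex.le_iff] <;>
    grind

lemma BarShiftLE.exists_common {δ : ℝ} {I J K : Bar} (hJ : J.2 ≠ ⊥)
    (hIJ : BarShiftLE δ I J) (hJK : BarShiftLE δ J K) (h : I.key ≤ K.key)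
    (hI : BarLong δ I) (hK : BarLong δ K) :
    ∃ t, Bar.has I t ∧ Bar.has K (t + δ + δ) := by
  obtain ⟨a, b⟩ := I
  obtain ⟨c, d⟩ := J
  obtain ⟨a', b'⟩ := K
  induction b' with
  | bot => simp [BarLong] at hK
  | coe b' =>
    refine ⟨b' - δ - δ, ?_⟩
    induction b <;> induction d <;>
      simp_all [barShiftLE_coe_coe, barShiftLE_top_left, not_barShiftLE_coe_top, Bar.key,
        Prod.Lex.le_iff, BarLong, Bar.has, ← EReal.coe_sub, -EReal.coe_mul] <;>
      norm_cast at * <;> grind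
  | top =>
    refine ⟨a + 1, ?_⟩
    have hb : b ≠ ⊥ := by
      rintro rfl
      simp [BarLong] at hI
    induction b <;> induction d <;>
      simp_all [barShiftLE_top_left, not_barShiftLE_coe_top, Bar.has]
    linarith

lemma BarLong.exists_has {δ : ℝ} (hδ : 0 < δ) {I : Bar} (hI : BarLong δ I) :
    ∃ t, Bar.has I t ∧ Bar.has I (t + δ + δ) := by
  have hb : I.2 ≠ ⊥ := by
    rintro h
    simp [BarLong, h] at hI
  have h : BarShiftLE δ I I :=
    ⟨by linarith, fun r hr => le_trans (by exact_mod_cast by linarith) hr⟩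
  exact h.exists_common hb h le_rfl hI hI

lemma Bar.has_mid {δ t : ℝ} {I J K : Bar} (hIJ : BarShiftLE δ I J) (hJK : BarShiftLE δ J K)
    (hI : Bar.has I t) (hK : Bar.has K (t + δ + δ)) : Bar.has J (t + δ) :=
  ⟨by linarith [hIJ.1, hI.1], hJK.2 _ hK.2⟩

lemma BarLong.of_has {δ t : ℝ} {I : Bar} (h : Bar.has I t) (h' : Bar.has I (t + δ + δ)) :
    BarLong δ I := by
  obtain ⟨a, b⟩ := I
  induction b <;> simp_all [Bar.has, BarLong, ← EReal.coe_sub, -EReal.coe_mul]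
  norm_cast at *
  linarith

end BarGeometry

section PiModule

variable {𝔽 : Type} [Field 𝔽] {ι κ : Type}

/-- The transition maps of the direct sum of the interval modules of a family of bars. -/
noncomputable def piBarMap (𝔽 : Type) [Field 𝔽] (I : ι → Bar) (s t : ℝ) :
    (∀ i, barSub 𝔽 (I i) s) →ₗ[𝔽] ∀ i, barSub 𝔽 (I i) t :=
  LinearMap.pi fun i => (barMap 𝔽 (I i) s t).comp (LinearMap.proj i)

lemma piBarMap_coe (I : ι → Bar) (s t : ℝ) (x : ∀ i, barSub 𝔽 (I i) s) (i : ι) :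
    (piBarMap 𝔽 I s t x i : 𝔽) = if Bar.has (I i) t then (x i : 𝔽) else 0 := rfl

/-- Families of linear maps forming a morphism `⊕ 𝔽(I i) → (⊕ 𝔽(J j))[δ]`. -/
def IsShiftHom (δ : ℝ) (I : ι → Bar) (J : κ → Bar)
    (F : ∀ t, (∀ i, barSub 𝔽 (I i) t) →ₗ[𝔽] ∀ j, barSub 𝔽 (J j) (t + δ)) : Prop :=
  ∀ s t, s ≤ t → (F t).comp (piBarMap 𝔽 I s t) = (piBarMap 𝔽 J (s + δ) (t + δ)).comp (F s)

/-- The generator of the interval module of `I` at `t`, or `0` outside the bar. -/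
noncomputable def barUnit (𝔽 : Type) [Field 𝔽] (I : Bar) (t : ℝ) : barSub 𝔽 I t :=
  ⟨if Bar.has I t then 1 else 0, by
    split_ifs with h
    · simp [barSub, h]
    · exact (barSub 𝔽 I t).zero_mem⟩

lemma barUnit_coe (I : Bar) (t : ℝ) :
    (barUnit 𝔽 I t : 𝔽) = if Bar.has I t then 1 else 0 := rfl

lemma smul_barUnit {I : Bar} {t : ℝ} (x : barSub 𝔽 I t) : (x : 𝔽) • barUnit 𝔽 I t = x := by
  apply Subtype.ext
  by_cases h : Bar.has I t
  · simp [barUnit_coe, h]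
  · simp [barSub_coe_zero h x]

lemma barUnit_eq_zero {I : Bar} {t : ℝ} (h : ¬ Bar.has I t) : barUnit 𝔽 I t = 0 := by
  apply Subtype.ext
  simp [barUnit_coe, h]

lemma piBarMap_single (I : ι → Bar) {s t : ℝ} {i : ι} (hs : Bar.has (I i) s) :
    piBarMap 𝔽 I s t (Pi.single i (barUnit 𝔽 (I i) s)) =
      Pi.single i (barUnit 𝔽 (I i) t) := by
  funext k
  apply Subtype.ext
  rw [piBarMap_coe]
  by_cases hk : k = i
  · subst hk
    simp [barUnit_coe, hs]
  · simp [Pi.single_eq_of_ne hk]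

lemma eq_sum_smul_single [Fintype ι] (I : ι → Bar) {t : ℝ} (x : ∀ i, barSub 𝔽 (I i) t) :
    x = ∑ i, (x i : 𝔽) • Pi.single i (barUnit 𝔽 (I i) t) := by
  conv_lhs => rw [← Finset.univ_sum_single x]
  refine Finset.sum_congr rfl fun i _ => ?_
  rw [← Pi.single_smul, smul_barUnit]

/-- A shifted morphism between sums of interval modules is given by a matrix of scalars. -/
lemma IsShiftHom.exists_coeff [Fintype ι] {δ : ℝ} {I : ι → Bar} {J : κ → Bar}
    {F : ∀ t, (∀ i, barSub 𝔽 (I i) t) →ₗ[𝔽] ∀ j, barSub 𝔽 (J j) (t + δ)}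
    (hF : IsShiftHom δ I J F) :
    ∃ f : κ → ι → 𝔽, (∀ j i, f j i ≠ 0 → BarShiftLE δ (I i) (J j)) ∧
      ∀ t x j, Bar.has (J j) (t + δ) → (F t x j : 𝔽) = ∑ i, f j i * (x i : 𝔽) := by
  set φ : ℝ → κ → ι → 𝔽 :=
    fun t j i => (F t (Pi.single i (barUnit 𝔽 (I i) t)) j : 𝔽) with hφ
  have nat : ∀ {s t : ℝ} (i : ι) (j : κ), s ≤ t → Bar.has (I i) s →
      φ t j i = if Bar.has (J j) (t + δ) then φ s j i else 0 := by
    intro s t i j hst hs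
    have h := congrArg (fun L => (L (Pi.single i (barUnit 𝔽 (I i) s)) j : 𝔽)) (hF s t hst)
    simpa only [LinearMap.comp_apply, piBarMap_single I hs, piBarMap_coe] using h
  have hasI : ∀ {t i j}, φ t j i ≠ 0 → Bar.has (I i) t := by
    intro t i j h
    by_contra hn
    simp [hφ, barUnit_eq_zero hn] at h
  have hasJ : ∀ {t i j}, φ t j i ≠ 0 → Bar.has (J j) (t + δ) := by
    intro t i j h
    by_contra hn
    exact h (barSub_coe_zero hn _)
  have const : ∀ {s t i j}, Bar.has (I i) s → Bar.has (I i) t → Bar.has (J j) (s + δ) →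
      Bar.has (J j) (t + δ) → φ s j i = φ t j i := by
    intro s t i j h1 h2 h3 h4
    rcases le_total s t with h | h
    · rw [nat i j h h1, if_pos h4]
    · rw [nat i j h h2, if_pos h3]
  refine ⟨fun j i => if h : ∃ t, φ t j i ≠ 0 then φ h.choose j i else 0, ?_, ?_⟩
  · intro j i hji
    have hex : ∃ t, φ t j i ≠ 0 := by
      by_contra h
      simp [h] at hji
    obtain ⟨t, ht⟩ := hex
    have hI := hasI ht
    have hJ := hasJ ht
    refine ⟨?_, fun r hr => ?_⟩
    · by_contra! hlt
      have hle : (J j).1 - δ ≤ t := by linarith [hJ.1]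
      have hs : Bar.has (I i) ((J j).1 - δ) :=
        ⟨by linarith, le_trans (by exact_mod_cast hle) hI.2⟩
      have h0 : φ ((J j).1 - δ) j i = 0 := by
        by_contra h
        have := (hasJ h).1
        linarith
      rw [nat i j hle hs, h0, ite_self] at ht
      exact ht rfl
    · rcases le_total r t with hrt | hrt
      · exact le_trans (by exact_mod_cast hrt) hI.2
      · have hr' : Bar.has (J j) (r + δ) := ⟨by linarith [hJ.1], hr⟩
        have h := nat i j hrt hI
        rw [if_pos hr'] at h
        exact (hasI (h ▸ ht)).2
  · intro t x j hJ
    conv_lhs => rw [eq_sum_smul_single I x]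
    simp only [map_sum, map_smul, Finset.sum_apply, Pi.smul_apply, AddSubmonoidClass.coe_finsetSum,
      Submodule.coe_smul, smul_eq_mul]
    refine Finset.sum_congr rfl fun i _ => ?_
    by_cases hI : Bar.has (I i) t
    · rw [mul_comm]
      congr 1
      change φ t j i = _
      split_ifs with h
      · exact const hI (hasI h.choose_spec) hJ (hasJ h.choose_spec)
      · push Not at h
        exact h t
    · simp [barSub_coe_zero hI]

lemma card_le_card_of_interleaving [Fintype ι] [Fintype κ] {δ : ℝ} (hδ : 0 < δ) {I : ι → Bar}
    {J : κ → Bar} (hJ : ∀ j, Bar.valid (J j))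
    {F : ∀ t, (∀ i, barSub 𝔽 (I i) t) →ₗ[𝔽] ∀ j, barSub 𝔽 (J j) (t + δ)}
    {G : ∀ t, (∀ j, barSub 𝔽 (J j) t) →ₗ[𝔽] ∀ i, barSub 𝔽 (I i) (t + δ)}
    (hF : IsShiftHom δ I J F) (hG : IsShiftHom δ J I G)
    (hGF : ∀ t, (G (t + δ)).comp (F t) = piBarMap 𝔽 I t (t + δ + δ))
    {A : Finset ι} {N : Finset κ} (hA : ∀ i ∈ A, BarLong δ (I i))
    (hN : ∀ i ∈ A, ∀ j, BarClose δ (I i) (J j) → j ∈ N) :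
    A.card ≤ N.card := by
  obtain ⟨f, hf, hFf⟩ := hF.exists_coeff
  obtain ⟨g, hg, hGg⟩ := hG.exists_coeff
  have hI : ∀ i ∈ A, (I i).2 ≠ ⊥ := by
    intro i hi h
    have := hA i hi
    simp [BarLong, h] at this
  have hle : ∀ {i k j}, g k j * f j i ≠ 0 → BarShiftLE δ (I i) (J j) ∧ BarShiftLE δ (J j) (I k) :=
    fun h => ⟨hf _ _ (right_ne_zero_of_mul h), hg _ _ (left_ne_zero_of_mul h)⟩
  have comp : ∀ i ∈ A, ∀ k ∈ A, (I i).key ≤ (I k).key →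
      ∑ j ∈ N, g k j * f j i = if k = i then 1 else 0 := by
    intro i hi k hk hik
    rw [Finset.sum_subset (Finset.subset_univ N)]
    swap
    · intro j _ hj
      by_contra h
      obtain ⟨h1, h2⟩ := hle h
      rcases h1.close_or_close (hI i hi) (hJ j).ne_bot (hI k hk) h2 hik with h | h
      · exact hj (hN i hi j h)
      · exact hj (hN k hk j h)
    by_cases hex : ∃ t, Bar.has (I i) t ∧ Bar.has (I k) (t + δ + δ)
    · obtain ⟨t, h1, h2⟩ := hex
      have h := congrArg (fun L => (L (Pi.single i (barUnit 𝔽 (I i) t)) k : 𝔽)) (hGF t)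
      simp only [LinearMap.comp_apply, piBarMap_coe, hGg _ _ _ h2, if_pos h2] at h
      have hs : ∀ l, ((Pi.single i (barUnit 𝔽 (I i) t) : ∀ l, barSub 𝔽 (I l) t) l : 𝔽) =
          if l = i then 1 else 0 := by
        intro l
        by_cases hl : l = i
        · subst hl
          simp [barUnit_coe, h1]
        · simp [hl]
      rw [hs] at h
      rw [← h]
      refine Finset.sum_congr rfl fun j _ => ?_
      by_cases hj : Bar.has (J j) (t + δ)
      · simp [hFf _ _ _ hj, hs]
      · rw [barSub_coe_zero hj, mul_zero]
        by_contra h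
        obtain ⟨h3, h4⟩ := hle h
        exact hj (Bar.has_mid h3 h4 h1 h2)
    · rw [if_neg]
      · refine Finset.sum_eq_zero fun j _ => ?_
        by_contra h
        obtain ⟨h1, h2⟩ := hle h
        exact hex (h1.exists_common (hJ j).ne_bot h2 hik (hA i hi) (hA k hk))
      · rintro rfl
        exact hex ((hA k hk).exists_has hδ)
  let L : (A → 𝔽) →ₗ[𝔽] (N → 𝔽) :=
    Matrix.mulVecLin (Matrix.of fun (j : N) (i : A) => f j i)
  have hL : Function.Injective L := by
    rw [← LinearMap.ker_eq_bot, LinearMap.ker_eq_bot']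
    intro v hv
    by_contra hne
    obtain ⟨i₀, hi₀⟩ := Function.ne_iff.mp hne
    obtain ⟨k, hk, hmax⟩ := Finset.exists_max_image
      (Finset.univ.filter fun i : A => v i ≠ 0) (fun i => (I i).key) ⟨i₀, by simpa using hi₀⟩
    have hk : v k ≠ 0 := by simpa using hk
    apply hk
    have h0 : ∀ j : N, ∑ i : A, f j i * v i = 0 := fun j => congrFun hv j
    calc v k = ∑ i : A, (if (k : ι) = i then 1 else 0) * v i := by
          simp
      _ = ∑ i : A, (∑ j ∈ N, g k j * f j i) * v i := by
          refine Finset.sum_congr rfl fun i _ => ?_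
          by_cases hi : v i = 0
          · simp [hi]
          · rw [comp i i.2 k k.2 (hmax i (by simpa using hi))]
      _ = ∑ j ∈ N, g k j * ∑ i : A, f j i * v i := by
          simp only [Finset.sum_mul, Finset.mul_sum, mul_assoc]
          rw [Finset.sum_comm]
      _ = 0 := Finset.sum_eq_zero fun j hj => by rw [h0 ⟨j, hj⟩, mul_zero]
  simpa using card_le_of_injective 𝔽 L hL

end PiModule

section IndexMatching

variable {ι κ : Type} [Fintype ι] [Fintype κ]

/-- If Hall's condition holds from `P` to `κ` and from `Q` to `ι`, there is a partial matching
inside `R` covering both `P` and `Q`. -/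
lemma exists_partial_matching_of_hall (R : ι → κ → Prop) (P : ι → Prop) (Q : κ → Prop)
    (hP : ∀ A : Finset ι, (∀ i ∈ A, P i) →
      A.card ≤ (Finset.univ.filter fun j => ∃ i ∈ A, R i j).card)
    (hQ : ∀ D : Finset κ, (∀ j ∈ D, Q j) →
      D.card ≤ (Finset.univ.filter fun i => ∃ j ∈ D, R i j).card) :
    ∃ S : Finset (ι × κ), Set.InjOn Prod.fst (S : Set (ι × κ)) ∧
      Set.InjOn Prod.snd (S : Set (ι × κ)) ∧ (∀ i, P i → ∃ j, (i, j) ∈ S) ∧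
      (∀ j, Q j → ∃ i, (i, j) ∈ S) ∧ ∀ p ∈ S, R p.1 p.2 := by
  let T : ι ⊕ κ → κ ⊕ ι → Prop :=
    Sum.elim (fun i => Sum.elim (fun j => R i j) (fun i' => i' = i ∧ ¬ P i))
      (fun j => Sum.elim (fun j' => j' = j ∧ ¬ Q j) (fun _ => True))
  obtain ⟨f, hf, hT⟩ := (Fintype.all_card_le_filter_rel_iff_exists_injective T).mp (by
    intro X
    set N : Finset (κ ⊕ ι) := Finset.univ.filter fun b => ∃ a ∈ X, T a b with hN
    rw [← X.card_toLeft_add_card_toRight, ← N.card_toLeft_add_card_toRight]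
    rcases X.toRight.eq_empty_or_nonempty with hD | ⟨j₀, hj₀⟩
    · rw [hD, Finset.card_empty, add_zero,
        ← Finset.card_filter_add_card_filter_not (s := X.toLeft) P]
      refine Nat.add_le_add ((hP _ (by simp)).trans (Finset.card_le_card ?_))
        (Finset.card_le_card ?_)
      · intro j hj
        simp only [Finset.mem_filter, Finset.mem_univ, true_and, Finset.mem_toLeft] at hj
        obtain ⟨i, ⟨hi, -⟩, hij⟩ := hj
        simp only [hN, Finset.mem_toLeft, Finset.mem_filter, Finset.mem_univ, true_and]
        exact ⟨_, hi, hij⟩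
      · intro i hi
        simp only [Finset.mem_filter, Finset.mem_toLeft] at hi
        simp only [hN, Finset.mem_toRight, Finset.mem_filter, Finset.mem_univ, true_and]
        exact ⟨_, hi.1, rfl, hi.2⟩
    · have huniv : N.toRight = Finset.univ := by
        ext i
        simp only [hN, Finset.mem_toRight, Finset.mem_filter, Finset.mem_univ, true_and, iff_true]
        exact ⟨_, Finset.mem_toRight.mp hj₀, trivial⟩
      rw [huniv, ← Finset.card_filter_add_card_filter_not (s := X.toRight)
        (fun j => Q j ∧ ∀ i ∈ X.toLeft, ¬ R i j)]
      have h1 := hQ (X.toRight.filter fun j => Q j ∧ ∀ i ∈ X.toLeft, ¬ R i j)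
        (fun j hj => (Finset.mem_filter.mp hj).2.1)
      have h2 : (X.toRight.filter fun j => ¬ (Q j ∧ ∀ i ∈ X.toLeft, ¬ R i j)).card ≤
          N.toLeft.card := by
        refine Finset.card_le_card fun j hj => ?_
        simp only [Finset.mem_filter, Finset.mem_toRight, not_and_or, not_forall, not_not] at hj
        simp only [hN, Finset.mem_toLeft, Finset.mem_filter, Finset.mem_univ, true_and]
        rcases hj with ⟨hj, hq | ⟨i, hi, hij⟩⟩
        · exact ⟨_, hj, rfl, hq⟩
        · exact ⟨_, Finset.mem_toLeft.mp hi, hij⟩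
      have h3 : Disjoint X.toLeft (Finset.univ.filter fun i =>
          ∃ j ∈ X.toRight.filter fun j => Q j ∧ ∀ i ∈ X.toLeft, ¬ R i j, R i j) := by
        rw [Finset.disjoint_left]
        intro i hi hi'
        simp only [Finset.mem_filter, Finset.mem_univ, true_and] at hi'
        obtain ⟨j, ⟨-, -, hj⟩, hij⟩ := hi'
        exact hj i hi hij
      have h4 := Finset.card_le_univ (X.toLeft.disjUnion _ h3)
      rw [Finset.card_disjUnion] at h4
      rw [Finset.card_univ]
      omega)
  have hsurj : Function.Surjective f :=
    ((Fintype.bijective_iff_injective_and_card f).mpr ⟨hf, by simp [add_comm]⟩).2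
  refine ⟨Finset.univ.filter fun p => f (Sum.inl p.1) = Sum.inl p.2, ?_, ?_, ?_, ?_, ?_⟩
  · rintro ⟨i, j⟩ h ⟨i', j'⟩ h' (rfl : i = i')
    simp only [Finset.coe_filter, Finset.mem_univ, true_and, Set.mem_ofPred_eq] at h h'
    rw [Sum.inl.inj (h.symm.trans h')]
  · rintro ⟨i, j⟩ h ⟨i', j'⟩ h' (rfl : j = j')
    simp only [Finset.coe_filter, Finset.mem_univ, true_and, Set.mem_ofPred_eq] at h h'
    rw [Sum.inl.inj (hf (h.trans h'.symm))]
  · intro i hi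
    have h := hT (Sum.inl i)
    rcases hfi : f (Sum.inl i) with j | i'
    · exact ⟨j, by simpa using hfi⟩
    · rw [hfi] at h
      exact absurd hi h.2
  · intro j hj
    obtain ⟨x, hx⟩ := hsurj (Sum.inl j)
    have h := hT x
    rw [hx] at h
    rcases x with i | j'
    · exact ⟨i, by simpa using hx⟩
    · obtain ⟨rfl, h⟩ := h
      exact absurd hj h
  · rintro ⟨i, j⟩ h
    have h' := hT (Sum.inl i)
    rw [(Finset.mem_filter.mp h).2] at h'
    exact h'

/-- A `δ`-matching between indexed families of bars, as a set of pairs of indices. -/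
def IsIndexMatching (δ : ℝ) (I : ι → Bar) (J : κ → Bar) (S : Finset (ι × κ)) : Prop :=
  Set.InjOn Prod.fst (S : Set (ι × κ)) ∧ Set.InjOn Prod.snd (S : Set (ι × κ)) ∧
    (∀ i, BarLong δ (I i) → ∃ j, (i, j) ∈ S) ∧ (∀ j, BarLong δ (J j) → ∃ i, (i, j) ∈ S) ∧
    ∀ p ∈ S, BarClose δ (I p.1) (J p.2)

lemma map_univ_sub {α β : Type} [Fintype β] {S : Finset α} {e : α → β}
    (he : Set.InjOn e (S : Set α)) (h : β → Bar) {p : Bar → Prop}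
    (hp : ∀ b, p (h b) → ∃ a ∈ S, e a = b) :
    S.val.map (h ∘ e) ≤ (Finset.univ : Finset β).val.map h ∧
      cfilter p ((Finset.univ : Finset β).val.map h) ≤ S.val.map (h ∘ e) := by
  have hS : S.val.map (h ∘ e) = (S.image e).val.map h := by
    rw [Finset.image_val_of_injOn he, Multiset.map_map]
  rw [hS]
  refine ⟨Multiset.map_le_map (Finset.val_le_iff.mpr (Finset.subset_univ _)), ?_⟩
  unfold cfilter
  rw [Multiset.filter_map, ← Finset.filter_val]
  refine Multiset.map_le_map (Finset.val_le_iff.mpr fun b hb => ?_)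
  obtain ⟨a, ha, rfl⟩ := hp b (Finset.mem_filter.mp hb).2
  exact Finset.mem_image_of_mem e ha

lemma exists_index_map {α β : Type} [Fintype α] [Fintype β] {g : α → Bar} {h : β → Bar}
    {p : Bar → Prop}
    (hle : (Finset.univ : Finset α).val.map g ≤ (Finset.univ : Finset β).val.map h)
    (hp : cfilter p ((Finset.univ : Finset β).val.map h) ≤
      (Finset.univ : Finset α).val.map g) :
    ∃ e : α → β, Function.Injective e ∧ (∀ a, h (e a) = g a) ∧ ∀ b, p (h b) → ∃ a, e a = b := by
  have key : ∀ c, Nonempty ({a // g a = c} ↪ {b // h b = c}) := by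
    intro c
    refine Function.Embedding.nonempty_of_card_le ?_
    have := Multiset.count_le_of_le c hle
    simpa [Multiset.count_map, Fintype.card_subtype, eq_comm, ← Finset.filter_val] using this
  let E := fun c => (key c).some
  have hE : ∀ a, h (E (g a) ⟨a, rfl⟩) = g a := fun a => (E (g a) ⟨a, rfl⟩).2
  have hE' : ∀ a c (hc : g a = c), (E c ⟨a, hc⟩ : β) = E (g a) ⟨a, rfl⟩ := by
    rintro a _ rfl
    rfl
  refine ⟨fun a => E (g a) ⟨a, rfl⟩, ?_, hE, ?_⟩
  · intro a a' haa
    dsimp only at haa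
    have hg : g a = g a' := by rw [← hE a, ← hE a', haa]
    rw [← hE' a (g a') hg, Subtype.coe_inj] at haa
    exact congrArg Subtype.val ((E (g a')).injective haa)
  · intro b hb
    have hcard : Fintype.card {b' // h b' = h b} ≤ Fintype.card {a // g a = h b} := by
      have := Multiset.count_le_of_le (h b) hp
      rw [cfilter, Multiset.count_filter_of_pos hb] at this
      simpa [Multiset.count_map, Fintype.card_subtype, eq_comm, ← Finset.filter_val] using this
    obtain ⟨⟨a, ha⟩, hab⟩ := ((Fintype.bijective_iff_injective_and_card (E (h b))).mpr
      ⟨(E (h b)).injective,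
        (Fintype.card_le_of_embedding (E (h b))).antisymm hcard⟩).2 ⟨b, rfl⟩
    exact ⟨a, (hE' a (h b) ha).symm.trans (congrArg Subtype.val hab)⟩

lemma map_univ_get_toList {α : Type} (m : Multiset α) :
    (Finset.univ : Finset (Fin m.toList.length)).val.map m.toList.get = m := by
  rw [Fin.univ_val_map, List.ofFn_get, Multiset.coe_toList]

lemma exists_isMatching_iff {δ : ℝ} {I : ι → Bar} {J : κ → Bar} :
    (∃ m, IsMatching δ (Finset.univ.val.map I) (Finset.univ.val.map J) m) ↔
      ∃ S, IsIndexMatching δ I J S := by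
  constructor
  · rintro ⟨m, h1, h2, h3, h4, h5⟩
    have hm : ∀ h : Bar × Bar → Bar,
        m.map h = (Finset.univ : Finset (Fin m.toList.length)).val.map (h ∘ m.toList.get) := by
      intro h
      rw [← Multiset.map_map, map_univ_get_toList]
    rw [hm] at h1 h2 h3 h4
    obtain ⟨e, he, hIe, hel⟩ := exists_index_map h1 h3
    obtain ⟨e', he', hJe, hel'⟩ := exists_index_map h2 h4
    refine ⟨Finset.univ.image fun k => (e k, e' k), ?_, ?_, ?_, ?_, ?_⟩
    · intro x hx y hy hxy
      simp only [Finset.coe_image, Finset.coe_univ, Set.image_univ, Set.mem_range] at hx hy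
      obtain ⟨k, rfl⟩ := hx
      obtain ⟨l, rfl⟩ := hy
      rw [he hxy]
    · intro x hx y hy hxy
      simp only [Finset.coe_image, Finset.coe_univ, Set.image_univ, Set.mem_range] at hx hy
      obtain ⟨k, rfl⟩ := hx
      obtain ⟨l, rfl⟩ := hy
      rw [he' hxy]
    · intro i hi
      obtain ⟨k, rfl⟩ := hel i hi
      exact ⟨e' k, Finset.mem_image_of_mem (fun k => (e k, e' k)) (Finset.mem_univ k)⟩
    · intro j hj
      obtain ⟨k, rfl⟩ := hel' j hj
      exact ⟨e k, Finset.mem_image_of_mem (fun k => (e k, e' k)) (Finset.mem_univ k)⟩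
    · intro x hx
      obtain ⟨k, -, rfl⟩ := Finset.mem_image.mp hx
      dsimp only
      rw [hIe, hJe]
      exact h5 _ (Multiset.mem_toList.mp (List.get_mem _ _))
  · rintro ⟨S, h1, h2, h3, h4, h5⟩
    obtain ⟨hI, hI'⟩ := map_univ_sub h1 I (p := BarLong δ) fun i hi =>
      (h3 i hi).imp' (fun j => (i, j)) fun j hj => ⟨hj, rfl⟩
    obtain ⟨hJ, hJ'⟩ := map_univ_sub h2 J (p := BarLong δ) fun j hj =>
      (h4 j hj).imp' (fun i => (i, j)) fun i hi => ⟨hi, rfl⟩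
    refine ⟨S.val.map fun p => (I p.1, J p.2), ?_⟩
    simp only [IsMatching, Multiset.map_map]
    refine ⟨hI, hJ, hI', hJ', fun p hp => ?_⟩
    obtain ⟨x, hx, rfl⟩ := Multiset.mem_map.mp hp
    exact h5 x hx

end IndexMatching

section Interleaving

variable {𝔽 : Type} [Field 𝔽] {ι κ : Type}

/-- The canonical map from the fiber of `𝔽(I)` at `s` to the fiber of `𝔽(J)` at `t`. -/
noncomputable def barTransfer (𝔽 : Type) [Field 𝔽] (I J : Bar) (s t : ℝ) :
    barSub 𝔽 I s →ₗ[𝔽] barSub 𝔽 J t :=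
  LinearMap.codRestrict (barSub 𝔽 J t)
    ((if Bar.has J t then (1 : 𝔽) else 0) • (barSub 𝔽 I s).subtype) (by
      intro x
      split_ifs with h
      · simp [barSub, h]
      · simp)

lemma barTransfer_coe (I J : Bar) (s t : ℝ) (x : barSub 𝔽 I s) :
    (barTransfer 𝔽 I J s t x : 𝔽) = if Bar.has J t then (x : 𝔽) else 0 := by
  by_cases h : Bar.has J t <;> simp [barTransfer, h]

/-- The morphism between sums of interval modules induced by a relation on the indices
under which each target index has at most one partner. -/
noncomputable def matchMap (δ : ℝ) (I : ι → Bar) (J : κ → Bar) (R : ι → κ → Prop) (t : ℝ) :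
    (∀ i, barSub 𝔽 (I i) t) →ₗ[𝔽] ∀ j, barSub 𝔽 (J j) (t + δ) :=
  LinearMap.pi fun j =>
    if h : ∃ i, R i j then
      (barTransfer 𝔽 (I h.choose) (J j) t (t + δ)).comp (LinearMap.proj h.choose)
    else 0

lemma matchMap_of_rel {δ : ℝ} {I : ι → Bar} {J : κ → Bar} {R : ι → κ → Prop}
    (hR : ∀ i i' j, R i j → R i' j → i = i') {i : ι} {j : κ} (hij : R i j) (t : ℝ)
    (x : ∀ i, barSub 𝔽 (I i) t) :
    (matchMap δ I J R t x j : 𝔽) = if Bar.has (J j) (t + δ) then (x i : 𝔽) else 0 := by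
  have h : ∃ i, R i j := ⟨i, hij⟩
  have hi : h.choose = i := hR _ _ _ h.choose_spec hij
  simp only [matchMap, LinearMap.pi_apply, dif_pos h, LinearMap.comp_apply, LinearMap.proj_apply,
    barTransfer_coe]
  rw [hi]

lemma matchMap_of_not_rel {δ : ℝ} {I : ι → Bar} {J : κ → Bar} {R : ι → κ → Prop} {j : κ}
    (hj : ¬ ∃ i, R i j) (t : ℝ) (x : ∀ i, barSub 𝔽 (I i) t) :
    (matchMap δ I J R t x j : 𝔽) = 0 := by
  simp [matchMap, dif_neg hj]

lemma isShiftHom_matchMap {δ : ℝ} {I : ι → Bar} {J : κ → Bar} {R : ι → κ → Prop}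
    (hR : ∀ i i' j, R i j → R i' j → i = i')
    (hle : ∀ i j, R i j → BarShiftLE δ (I i) (J j)) :
    IsShiftHom (𝔽 := 𝔽) δ I J (matchMap δ I J R) := by
  intro s t hst
  refine LinearMap.ext fun x => funext fun j => Subtype.ext ?_
  simp only [LinearMap.comp_apply, piBarMap_coe]
  by_cases hj : ∃ i, R i j
  · obtain ⟨i, hij⟩ := hj
    rw [matchMap_of_rel hR hij, matchMap_of_rel hR hij, piBarMap_coe]
    by_cases ht : Bar.has (J j) (t + δ)
    · rw [if_pos ht, if_pos ht]
      by_cases hs : Bar.has (I i) s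
      · have h1 : Bar.has (I i) t := ⟨hs.1.trans_le hst, (hle i j hij).2 _ ht.2⟩
        have h2 : Bar.has (J j) (s + δ) :=
          ⟨by linarith [(hle i j hij).1, hs.1],
            le_trans (by exact_mod_cast by linarith) ht.2⟩
        rw [if_pos h1, if_pos h2]
      · simp [barSub_coe_zero hs]
    · simp [ht]
  · rw [matchMap_of_not_rel hj, matchMap_of_not_rel hj, ite_self]

lemma matchMap_comp_matchMap {δ : ℝ} {I : ι → Bar} {J : κ → Bar} {R : ι → κ → Prop}
    (hR : ∀ i i' j, R i j → R i' j → i = i') (hR' : ∀ j j' i, R i j → R i j' → j = j')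
    (hle : ∀ i j, R i j → BarShiftLE δ (I i) (J j) ∧ BarShiftLE δ (J j) (I i))
    (hlong : ∀ i, BarLong δ (I i) → ∃ j, R i j) (t : ℝ) :
    (matchMap δ J I (flip R) (t + δ)).comp (matchMap δ I J R t) =
      piBarMap 𝔽 I t (t + δ + δ) := by
  refine LinearMap.ext fun x => funext fun i => Subtype.ext ?_
  simp only [LinearMap.comp_apply, piBarMap_coe]
  by_cases hi : ∃ j, R i j
  · obtain ⟨j, hij⟩ := hi
    rw [matchMap_of_rel (R := flip R) hR' hij, matchMap_of_rel hR hij]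
    by_cases h : Bar.has (I i) t
    · by_cases h' : Bar.has (I i) (t + δ + δ)
      · rw [if_pos h', if_pos h', if_pos (Bar.has_mid (hle i j hij).1 (hle i j hij).2 h h')]
      · rw [if_neg h', if_neg h']
    · simp [barSub_coe_zero h]
  · rw [matchMap_of_not_rel (R := flip R) hi]
    by_cases h : Bar.has (I i) t
    · rw [if_neg fun h' => hi (hlong i (BarLong.of_has h h'))]
    · simp [barSub_coe_zero h]

/-- `δ`-interleavings of sums of interval modules. -/
def PiInterleaved (𝔽 : Type) [Field 𝔽] (δ : ℝ) (I : ι → Bar) (J : κ → Bar) : Prop :=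
  ∃ (F : ∀ t, (∀ i, barSub 𝔽 (I i) t) →ₗ[𝔽] ∀ j, barSub 𝔽 (J j) (t + δ))
    (G : ∀ t, (∀ j, barSub 𝔽 (J j) t) →ₗ[𝔽] ∀ i, barSub 𝔽 (I i) (t + δ)),
    IsShiftHom δ I J F ∧ IsShiftHom δ J I G ∧
    (∀ t, (G (t + δ)).comp (F t) = piBarMap 𝔽 I t (t + δ + δ)) ∧
    ∀ t, (F (t + δ)).comp (G t) = piBarMap 𝔽 J t (t + δ + δ)

lemma piInterleaved_iff [Fintype ι] [Fintype κ] {δ : ℝ} (hδ : 0 < δ) {I : ι → Bar}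
    {J : κ → Bar} (hI : ∀ i, Bar.valid (I i)) (hJ : ∀ j, Bar.valid (J j)) :
    PiInterleaved 𝔽 δ I J ↔ ∃ S, IsIndexMatching δ I J S := by
  constructor
  · rintro ⟨F, G, hF, hG, hGF, hFG⟩
    refine exists_partial_matching_of_hall (fun i j => BarClose δ (I i) (J j))
      (fun i => BarLong δ (I i)) (fun j => BarLong δ (J j)) ?_ ?_
    · intro A hA
      refine card_le_card_of_interleaving hδ hJ hF hG hGF hA fun i hi j hij => ?_
      simpa using ⟨i, hi, hij⟩
    · intro D hD
      refine card_le_card_of_interleaving hδ hI hG hF hFG hD fun j hj i hij => ?_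
      simpa using ⟨j, hj, hij.symm⟩
  · rintro ⟨S, h1, h2, h3, h4, h5⟩
    have hR : ∀ i i' j, (i, j) ∈ S → (i', j) ∈ S → i = i' := fun i i' j h h' =>
      congrArg Prod.fst (h2 h h' rfl)
    have hR' : ∀ j j' i, (i, j) ∈ S → (i, j') ∈ S → j = j' := fun j j' i h h' =>
      congrArg Prod.snd (h1 h h' rfl)
    have hle : ∀ i j, (i, j) ∈ S → BarShiftLE δ (I i) (J j) ∧ BarShiftLE δ (J j) (I i) :=
      fun i j h => (barClose_iff (hI i).ne_bot (hJ j).ne_bot).mp (h5 _ h)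
    exact ⟨matchMap δ I J fun i j => (i, j) ∈ S, matchMap δ J I (flip fun i j => (i, j) ∈ S),
      isShiftHom_matchMap hR fun i j h => (hle i j h).1,
      isShiftHom_matchMap hR' fun j i h => (hle i j h).2,
      matchMap_comp_matchMap hR hR' hle h3,
      matchMap_comp_matchMap (R := flip fun i j => (i, j) ∈ S) hR' hR
        (fun j i h => (hle i j h).symm) h4⟩

end Interleaving

namespace PersistenceModule

variable {𝔽 : Type} [Field 𝔽]

lemma Iso.symm {M N : PersistenceModule 𝔽} (h : Iso M N) : Iso N M := by
  obtain ⟨f, g, h1, h2⟩ := h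
  exact ⟨g, f, h2, h1⟩

lemma Hom.comm_apply {M N : PersistenceModule 𝔽} (f : Hom M N) {s t : ℝ} (h : s ≤ t)
    (x : M.V s) : f.A t (M.π s t h x) = N.π s t h (f.A s x) :=
  LinearMap.congr_fun (f.comm s t h) x

lemma Interleaved.of_iso {M M' N N' : PersistenceModule 𝔽} {δ : ℝ} (hM : Iso M M')
    (hN : Iso N N') (h : Interleaved M N δ) : Interleaved M' N' δ := by
  obtain ⟨f, f', h1, h2⟩ := hM
  obtain ⟨g, g', h3, h4⟩ := hN
  obtain ⟨F, G, hF, hG, hGF, hFG⟩ := h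
  refine ⟨fun t => (g.A (t + δ)).comp ((F t).comp (f'.A t)),
    fun t => (f.A (t + δ)).comp ((G t).comp (g'.A t)), ?_, ?_, ?_, ?_⟩
  · intro s t h
    ext x
    have := LinearMap.congr_fun (hF s t h) (f'.A s x)
    simp only [LinearMap.comp_apply] at this ⊢
    rw [f'.comm_apply, this, g.comm_apply]
  · intro s t h
    ext x
    have := LinearMap.congr_fun (hG s t h) (g'.A s x)
    simp only [LinearMap.comp_apply] at this ⊢
    rw [g'.comm_apply, this, f.comm_apply]
  · intro t h
    ext x
    have := LinearMap.congr_fun (hGF t h) (f'.A t x)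
    simp only [LinearMap.comp_apply] at this ⊢
    rw [h3, this, f.comm_apply, h2]
  · intro t h
    ext x
    have := LinearMap.congr_fun (hFG t h) (g'.A t x)
    simp only [LinearMap.comp_apply] at this ⊢
    rw [h1, this, g.comm_apply, h4]

lemma interleaved_congr {M M' N N' : PersistenceModule 𝔽} {δ : ℝ} (hM : Iso M M')
    (hN : Iso N N') : Interleaved M N δ ↔ Interleaved M' N' δ :=
  ⟨.of_iso hM hN, .of_iso hM.symm hN.symm⟩

lemma interleaved_barcodeModule_iff {δ : ℝ} (hδ : 0 < δ) (B C : Multiset Bar) :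
    Interleaved (barcodeModule 𝔽 B) (barcodeModule 𝔽 C) δ ↔
      PiInterleaved 𝔽 δ B.toList.get C.toList.get := by
  constructor
  · rintro ⟨F, G, hF, hG, hGF, hFG⟩
    exact ⟨F, G, hF, hG, fun t => hGF t (by linarith), fun t => hFG t (by linarith)⟩
  · rintro ⟨F, G, hF, hG, hGF, hFG⟩
    exact ⟨F, G, hF, hG, fun t _ => hGF t, fun t _ => hFG t⟩

end PersistenceModule

/-- **Isometry Theorem.** For any two persistence modules `M` and `N` with barcodes `B`
and `C`, one has `d_int(M,N) = d_bot(B,C)`. -/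
theorem isometry_theorem {𝔽 : Type} [Field 𝔽]
    (M N : PersistenceModule 𝔽) (hM : M.IsRegular) (hN : N.IsRegular)
    (B C : Multiset Bar) (hB : ∀ I ∈ B, Bar.valid I) (hC : ∀ I ∈ C, Bar.valid I)
    (hMB : PersistenceModule.Iso M (barcodeModule 𝔽 B))
    (hNC : PersistenceModule.Iso N (barcodeModule 𝔽 C)) :
    PersistenceModule.dInt M N = dBot B C := by
  unfold PersistenceModule.dInt dBot
  congr 1
  ext x
  refine exists_congr fun δ => and_congr_right fun hδ => and_congr_right fun _ => ?_
  have hB' : ∀ i, Bar.valid (B.toList.get i) := fun i =>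
    hB _ (Multiset.mem_toList.mp (List.get_mem _ _))
  have hC' : ∀ j, Bar.valid (C.toList.get j) := fun j =>
    hC _ (Multiset.mem_toList.mp (List.get_mem _ _))
  rw [PersistenceModule.interleaved_congr hMB hNC,
    PersistenceModule.interleaved_barcodeModule_iff hδ, piInterleaved_iff hδ hB' hC',
    ← exists_isMatching_iff, map_univ_get_toList, map_univ_get_toList]
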